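/- Let G be a group and let X and Y be cocompact G-trees. Then X and Y are related by an elementary deformation if and only if they have the same elliptic subgroups, i.e., a subgroup of G fixes a vertex of X if and only if it fixes a vertex of Y. -/

import Mathlib

universe u

/-- A `G`-tree: a simplicial tree together with an action of `G` by graph
automorphisms without inversions. -/
structure GTree (G : Type u) [Group G] : Type (u + 1) where
  V : Type u
  graph : SimpleGraph V
  isTree : graph.IsTree
  smul : G → V → V
  smul_one : ∀ x, smul 1 x = x
  smul_mul : ∀ γ δ x, smul (γ * δ) x = smul γ (smul δ x)
  smul_adj : ∀ (γ : G) ⦃x y : V⦄, graph.Adj x y → graph.Adj (smul γ x) (smul γ y)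
  no_inversions : ∀ (γ : G) (x y : V), graph.Adj x y → ¬(smul γ x = y ∧ smul γ y = x)

namespace GTree

variable {G : Type u} [Group G]

/-- Oriented edges of a `G`-tree. -/
def Edge (X : GTree G) : Type u := { p : X.V × X.V // X.graph.Adj p.1 p.2 }

/-- Initial vertex `∂₀ e` of an oriented edge. -/
def d0 {X : GTree G} (e : X.Edge) : X.V := e.1.1

/-- Terminal vertex `∂₁ e` of an oriented edge. -/
def d1 {X : GTree G} (e : X.Edge) : X.V := e.1.2

/-- The underlying geometric (unoriented) edge. -/
def esym {X : GTree G} (e : X.Edge) : Sym2 X.V := s(e.1.1, e.1.2)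

/-- Action of `G` on oriented edges. -/
def edgeSmul {X : GTree G} (γ : G) (e : X.Edge) : X.Edge :=
  ⟨(X.smul γ e.1.1, X.smul γ e.1.2), X.smul_adj γ e.2⟩

/-- Vertex stabilizer `G_x`. -/
def stab (X : GTree G) (x : X.V) : Subgroup G where
  carrier := { γ | X.smul γ x = x }
  one_mem' := X.smul_one x
  mul_mem' := by
    intro a b ha hb
    simp only [Set.mem_setOf_eq] at *
    rw [X.smul_mul, hb, ha]
  inv_mem' := by
    intro a ha
    simp only [Set.mem_setOf_eq] at *
    conv_lhs => rw [← ha]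
    rw [← X.smul_mul, inv_mul_cancel, X.smul_one]

/-- Edge stabilizer `G_e`: the elements fixing both endpoints (since the action
is without inversions, these are exactly the elements fixing the edge). -/
def edgeStab (X : GTree G) (e : X.Edge) : Subgroup G :=
  X.stab (d0 e) ⊓ X.stab (d1 e)

/-- An element of `G` is elliptic if it fixes a vertex. -/
def Elliptic (X : GTree G) (γ : G) : Prop := ∃ x, X.smul γ x = x

/-- A subgroup of `G` is elliptic if it fixes a vertex. -/
def FixesVertex (X : GTree G) (H : Subgroup G) : Prop := ∃ x, ∀ γ ∈ H, X.smul γ x = x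

/-- Two `G`-trees have the same elliptic subgroups. -/
def SameEllipticSubgroups (X Y : GTree G) : Prop :=
  ∀ H : Subgroup G, X.FixesVertex H ↔ Y.FixesVertex H

/-- The length function `ℓ_X(γ)`: the minimal vertex displacement. -/
noncomputable def transLen (X : GTree G) (γ : G) : ℕ :=
  sInf (Set.range fun x => X.graph.dist x (X.smul γ x))

/-- Cocompact: the quotient graph `G\X` is finite, i.e. there are finitely
many orbits of vertices and of edges. -/
def Cocompact (X : GTree G) : Prop :=
  Finite (Quot fun x y : X.V => ∃ γ, X.smul γ x = y) ∧
    Finite (Quot fun e f : X.Edge => ∃ γ, edgeSmul γ e = f)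

/-- Reduced: whenever `G_e = G_{∂₀ e}`, the endpoints of `e` are in the same
`G`-orbit. -/
def Reduced (X : GTree G) : Prop :=
  ∀ e : X.Edge, X.edgeStab e = X.stab (d0 e) → ∃ γ, X.smul γ (d0 e) = d1 e

/-- A nonempty `G`-invariant subtree (a nonempty invariant set of vertices that
is connected in the induced graph). -/
def IsInvariantSubtree (X : GTree G) (S : Set X.V) : Prop :=
  S.Nonempty ∧ (∀ γ, ∀ x ∈ S, X.smul γ x ∈ S) ∧
    ∀ x ∈ S, ∀ y ∈ S, ∃ p : X.graph.Walk x y, ∀ v ∈ p.support, v ∈ S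

/-- Minimal: there is no proper nonempty invariant subtree. -/
def Minimal (X : GTree G) : Prop :=
  ∀ S : Set X.V, X.IsInvariantSubtree S → S = Set.univ

/-- Strongly slide-free: minimal, and for all edges `e`, `f` with
`∂₀ e = ∂₀ f`, the inclusion `G_e ⊆ G_f` implies `f ∈ G e`. -/
def StronglySlideFree (X : GTree G) : Prop :=
  X.Minimal ∧ ∀ e f : X.Edge, d0 e = d0 f → X.edgeStab e ≤ X.edgeStab f →
    ∃ γ, edgeSmul γ e = f

/-- Proper: `G_e ⊊ G_{∂₀ e}` for every edge `e`. -/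
def Proper (X : GTree G) : Prop := ∀ e : X.Edge, X.edgeStab e < X.stab (d0 e)

/-- Locally finite: every vertex has finite valence. -/
def LocallyFinite (X : GTree G) : Prop := ∀ x : X.V, (X.graph.neighborSet x).Finite

/-- `φ` is an isomorphism of `G`-trees: an equivariant graph isomorphism. -/
def IsGIso (X Y : GTree G) (φ : X.V → Y.V) : Prop :=
  Function.Bijective φ ∧ (∀ x y, X.graph.Adj x y ↔ Y.graph.Adj (φ x) (φ y)) ∧
    ∀ γ x, φ (X.smul γ x) = Y.smul γ (φ x)

/-- `φ : X → Y` is the collapse move performed at (the orbit of) the edge `e`: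
`G_e = G_{∂₀ e}`, the endpoints of `e` lie in different `G`-orbits, and `Y` is
the equivariant quotient of `X` identifying `∂₀(γ e)` with `∂₁(γ e)` for all
`γ ∈ G`. -/
def IsCollapse (X Y : GTree G) (φ : X.V → Y.V) (e : X.Edge) : Prop :=
  X.edgeStab e = X.stab (d0 e) ∧
  (∀ γ : G, X.smul γ (d0 e) ≠ d1 e) ∧
  Function.Surjective φ ∧
  (∀ γ x, φ (X.smul γ x) = Y.smul γ (φ x)) ∧
  (∀ u v : X.V, φ u = φ v ↔
    Relation.EqvGen (fun a b => ∃ γ : G, a = X.smul γ (d0 e) ∧ b = X.smul γ (d1 e)) u v) ∧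
  (∀ a b : Y.V, a ≠ b → (Y.graph.Adj a b ↔ ∃ u v, X.graph.Adj u v ∧ φ u = a ∧ φ v = b))

/-- `Y` is obtained from `X` by a collapse move. -/
def Collapse (X Y : GTree G) : Prop := ∃ (φ : X.V → Y.V) (e : X.Edge), IsCollapse X Y φ e

/-- Elementary deformation: a finite composition of collapse moves and their
inverses (expansion moves). -/
def ElemDeformation : GTree G → GTree G → Prop := Relation.EqvGen Collapse

end GTree

namespace SimpleGraph

variable {V : Type*} {T : SimpleGraph V}

/-- Every edge of a tree is the only edge leaving some set of vertices. -/
theorem IsTree.exists_cut (hT : T.IsTree) {u v : V} (h : T.Adj u v) :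
    ∃ S : Set V, u ∈ S ∧ v ∉ S ∧ ∀ a b, T.Adj a b → a ∈ S → b ∉ S → a = u ∧ b = v := by
  have hb := isAcyclic_iff_forall_adj_isBridge.1 hT.isAcyclic h
  rw [isBridge_iff] at hb
  refine ⟨{w | (T.deleteEdges {s(u, v)}).Reachable u w}, Reachable.refl u, hb, ?_⟩
  intro a b hab ha hnb
  by_cases he : s(a, b) = s(u, v)
  · rcases Sym2.eq_iff.1 he with h' | ⟨rfl, rfl⟩
    · exact h'
    · exact absurd ha hb
  · exact absurd (Reachable.trans ha (Adj.reachable (by simp [hab, he]))) hnb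

/-- A connected graph in which every edge is the only edge leaving some set of vertices is a
tree. -/
theorem Connected.isTree_of_exists_cut (hc : T.Connected)
    (hcut : ∀ u v, T.Adj u v →
      ∃ S : Set V, u ∈ S ∧ v ∉ S ∧ ∀ a b, T.Adj a b → a ∈ S → b ∉ S → a = u ∧ b = v) :
    T.IsTree := by
  refine ⟨hc, isAcyclic_iff_forall_adj_isBridge.2 fun u v h => ?_⟩
  rw [isBridge_iff]
  rintro ⟨p⟩
  obtain ⟨S, hu, hv, hS⟩ := hcut u v h
  obtain ⟨d, -, hd₁, hd₂⟩ := p.exists_boundary_dart S hu hv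
  have hd := d.adj
  rw [deleteEdges_adj] at hd
  obtain ⟨h₁, h₂⟩ := hS _ _ hd.1 hd₁ hd₂
  exact hd.2 (by simp [h₁, h₂])

/-- A vertex of a tree has at most one neighbour closer to a given vertex. -/
theorem IsTree.eq_of_adj_of_dist_lt (hT : T.IsTree) {a b c x : V} (hb : T.Adj a b)
    (hc : T.Adj a c) (hbx : T.dist b x < T.dist a x) (hcx : T.dist c x < T.dist a x) :
    b = c := by
  have key : ∀ d, T.Adj a d → T.dist d x < T.dist a x →
      ∃ p : T.Path a x, p.1.snd = d := by
    intro d had hd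
    obtain ⟨p, hp, hl⟩ := hT.connected.exists_path_of_dist d x
    refine ⟨⟨Walk.cons had p, ?_⟩, by simp⟩
    refine Walk.isPath_of_length_eq_dist _ ?_
    have := had.diff_dist_adj (u := x)
    have h3 := T.dist_comm (u := x) (v := a)
    have h4 := T.dist_comm (u := x) (v := d)
    have h5 := T.dist_le (Walk.cons had p)
    simp only [Walk.length_cons] at *
    omega
  obtain ⟨p, rfl⟩ := key b hb hbx
  obtain ⟨q, rfl⟩ := key c hc hcx
  rw [(hT.isAcyclic.subsingleton_path a x).elim p q]

theorem Connected.exists_adj_dist (hT : T.Connected) {x y : V} (h : x ≠ y) :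
    ∃ s, T.Adj x s ∧ T.dist s y + 1 = T.dist x y := by
  obtain ⟨p, hp⟩ := hT.exists_walk_length_eq_dist x y
  cases p with
  | nil => exact absurd rfl h
  | @cons _ s _ hs p =>
    refine ⟨s, hs, ?_⟩
    have h1 := T.dist_le p
    have h2 := hs.diff_dist_adj (u := y)
    have h3 := T.dist_comm (u := y) (v := x)
    have h4 := T.dist_comm (u := y) (v := s)
    simp only [Walk.length_cons] at hp
    omega

/-- A map that sends adjacent vertices to equal or adjacent vertices is distance
nonincreasing. -/
theorem Connected.dist_le_of_adj {W : Type*} {H : SimpleGraph W} (hT : T.Connected)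
    (hH : H.Connected) (f : V → W) (hf : ∀ u v, T.Adj u v → f u = f v ∨ H.Adj (f u) (f v))
    (u v : V) : H.dist (f u) (f v) ≤ T.dist u v := by
  obtain ⟨p, hp⟩ := hT.exists_walk_length_eq_dist u v
  rw [← hp]
  clear hp
  induction p with
  | nil => simp
  | @cons a b c hab p ih =>
    have h1 := hH.dist_triangle (u := f a) (v := f b) (w := f c)
    have h2 : H.dist (f a) (f b) ≤ 1 := by
      rcases hf _ _ hab with h | h
      · simp [h]
      · rw [dist_eq_one_iff_adj.2 h]
    simp only [Walk.length_cons]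
    omega

theorem Connected.of_surjective {W : Type*} {H : SimpleGraph W} (hT : T.Connected)
    (f : V → W) (hs : f.Surjective) (hf : ∀ u v, T.Adj u v → H.Reachable (f u) (f v)) :
    H.Connected := by
  have : Nonempty W := hT.nonempty.map f
  refine ⟨fun x y => ?_⟩
  obtain ⟨u, rfl⟩ := hs x
  obtain ⟨v, rfl⟩ := hs y
  obtain ⟨p⟩ := hT.preconnected u v
  induction p with
  | nil => rfl
  | cons h p ih => exact (hf _ _ h).trans ih

end SimpleGraph

namespace GTree

variable {G : Type u} [Group G]

theorem inv_smul_smul (X : GTree G) (γ : G) (x : X.V) : X.smul γ⁻¹ (X.smul γ x) = x := by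
  rw [← X.smul_mul, inv_mul_cancel, X.smul_one]

theorem smul_injective (X : GTree G) (γ : G) : Function.Injective (X.smul γ) :=
  Function.LeftInverse.injective (X.inv_smul_smul γ)

theorem dist_smul (X : GTree G) (γ : G) (x y : X.V) :
    X.graph.dist (X.smul γ x) (X.smul γ y) = X.graph.dist x y := by
  have key : ∀ γ x y, X.graph.dist (X.smul γ x) (X.smul γ y) ≤ X.graph.dist x y := fun γ =>
    X.isTree.connected.dist_le_of_adj X.isTree.connected _ fun u v h => Or.inr (X.smul_adj γ h)
  refine le_antisymm (key γ x y) ?_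
  simpa only [inv_smul_smul] using key γ⁻¹ (X.smul γ x) (X.smul γ y)

/-- `f` is an equivariant map of vertex sets. -/
def Equivariant (X Y : GTree G) (f : X.V → Y.V) : Prop :=
  ∀ γ x, f (X.smul γ x) = Y.smul γ (f x)

theorem exists_equivariant_iff (X Y : GTree G) :
    (∃ f, Equivariant X Y f) ↔ ∀ H : Subgroup G, X.FixesVertex H → Y.FixesVertex H := by
  constructor
  · rintro ⟨f, hf⟩ H ⟨x, hx⟩
    exact ⟨f x, fun γ hγ => by rw [← hf, hx γ hγ]⟩
  · intro h
    have hs : ∀ x, ∃ y, ∀ γ, X.smul γ x = x → Y.smul γ y = y := fun x =>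
      h (X.stab x) ⟨x, fun γ hγ => hγ⟩
    choose φ hφ using hs
    let r : Setoid X.V :=
      { r := fun x y => ∃ γ, X.smul γ x = y
        iseqv := ⟨fun x => ⟨1, X.smul_one x⟩,
          fun {x y} ⟨γ, h⟩ => ⟨γ⁻¹, by rw [← h, inv_smul_smul]⟩,
          fun {x y z} ⟨γ, h⟩ ⟨δ, h'⟩ => ⟨δ * γ, by rw [X.smul_mul, h, h']⟩⟩ }
    have hrep : ∀ x : X.V, ∃ γ, X.smul γ (Quotient.mk r x).out = x := fun x =>
      Quotient.exact (Quotient.out_eq (Quotient.mk r x))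
    choose c hc using hrep
    refine ⟨fun x => Y.smul (c x) (φ (Quotient.mk r x).out), fun γ x => ?_⟩
    have hq : Quotient.mk r (X.smul γ x) = Quotient.mk r x :=
      Quotient.sound ⟨γ⁻¹, X.inv_smul_smul γ x⟩
    have h1 := hc (X.smul γ x)
    rw [hq] at h1
    dsimp only
    rw [hq]
    have h2 := hφ (Quotient.mk r x).out ((γ * c x)⁻¹ * c (X.smul γ x)) (by
      rw [X.smul_mul, h1, mul_inv_rev, X.smul_mul, inv_smul_smul]
      exact (congrArg (X.smul (c x)⁻¹) (hc x)).symm.trans (X.inv_smul_smul _ _))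
    rw [← Y.smul_mul]
    conv_rhs => rw [← h2]
    rw [← Y.smul_mul, mul_inv_cancel_left]

theorem sameEllipticSubgroups_iff (X Y : GTree G) :
    X.SameEllipticSubgroups Y ↔ (∃ f, Equivariant X Y f) ∧ ∃ g, Equivariant Y X g := by
  rw [exists_equivariant_iff, exists_equivariant_iff, ← forall_and]
  exact forall_congr' fun H => iff_iff_implies_and_implies

/-- Cocompactness in terms of finite sets of representatives. -/
theorem cocompact_iff (X : GTree G) : X.Cocompact ↔
    (∃ F : Set X.V, F.Finite ∧ ∀ x, ∃ γ, ∃ y ∈ F, X.smul γ y = x) ∧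
    ∃ F : Set (X.V × X.V), F.Finite ∧
      ∀ u v, X.graph.Adj u v → ∃ γ, ∃ p ∈ F, X.smul γ p.1 = u ∧ X.smul γ p.2 = v := by
  constructor
  · rintro ⟨hV, hE⟩
    constructor
    · refine ⟨Set.range fun q : Quot fun x y : X.V => ∃ γ, X.smul γ x = y => q.out,
        Set.finite_range _, fun x => ?_⟩
      have h := Quot.eqvGen_exact (Quot.out_eq (Quot.mk (fun x y : X.V => ∃ γ, X.smul γ x = y) x))
      have h' : ∃ γ, X.smul γ
          (Quot.mk (fun x y : X.V => ∃ γ, X.smul γ x = y) x).out = x := by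
        generalize Quot.out _ = y at h
        induction h with
        | rel _ _ h => exact h
        | refl x => exact ⟨1, X.smul_one x⟩
        | symm _ _ _ ih => obtain ⟨γ, rfl⟩ := ih; exact ⟨γ⁻¹, X.inv_smul_smul _ _⟩
        | trans _ _ _ _ _ ih₁ ih₂ =>
          obtain ⟨γ, rfl⟩ := ih₁
          obtain ⟨δ, rfl⟩ := ih₂
          exact ⟨δ * γ, X.smul_mul _ _ _⟩
      obtain ⟨γ, hγ⟩ := h'
      exact ⟨γ, _, ⟨_, rfl⟩, hγ⟩
    · have key : ∀ e f : X.Edge, Relation.EqvGen (fun e f : X.Edge => ∃ γ, edgeSmul γ e = f) e f →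
          ∃ γ, edgeSmul γ e = f := by
        intro e f h
        induction h with
        | rel _ _ h => exact h
        | refl x => exact ⟨1, Subtype.ext (by simp [edgeSmul, X.smul_one])⟩
        | symm _ _ _ ih =>
          obtain ⟨γ, rfl⟩ := ih
          exact ⟨γ⁻¹, Subtype.ext (by simp [edgeSmul, inv_smul_smul])⟩
        | trans _ _ _ _ _ ih₁ ih₂ =>
          obtain ⟨γ, rfl⟩ := ih₁
          obtain ⟨δ, rfl⟩ := ih₂
          exact ⟨δ * γ, Subtype.ext (by simp [edgeSmul, X.smul_mul])⟩
      refine ⟨Set.range fun q : Quot fun e f : X.Edge => ∃ γ, edgeSmul γ e = f => q.out.1,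
        Set.finite_range _, fun u v huv => ?_⟩
      obtain ⟨γ, hγ⟩ := key _ _ (Quot.eqvGen_exact
        (Quot.out_eq (Quot.mk (fun e f : X.Edge => ∃ γ, edgeSmul γ e = f) ⟨(u, v), huv⟩)))
      have h1 := congrArg Subtype.val hγ
      exact ⟨γ, _, ⟨Quot.mk _ ⟨(u, v), huv⟩, rfl⟩, congrArg Prod.fst h1, congrArg Prod.snd h1⟩
  · rintro ⟨⟨F, hF, h⟩, ⟨E, hE, h'⟩⟩
    constructor
    · have := hF.to_subtype
      refine Finite.of_surjective (fun x : F => Quot.mk _ x.1) fun q => ?_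
      induction q using Quot.ind with
      | mk x =>
        obtain ⟨γ, y, hy, rfl⟩ := h x
        exact ⟨⟨y, hy⟩, Quot.sound ⟨γ, rfl⟩⟩
    · let E' : Set X.Edge := (fun e : X.Edge => e.1) ⁻¹' E
      have : Finite E' :=
        (hE.preimage (Set.injOn_of_injective Subtype.val_injective)).to_subtype
      refine Finite.of_surjective (fun x : E' => Quot.mk _ x.1) fun q => ?_
      induction q using Quot.ind with
      | mk e =>
        obtain ⟨⟨u, v⟩, huv⟩ := e
        obtain ⟨γ, p, hp, rfl, rfl⟩ := h' u v huv
        have hadj : X.graph.Adj p.1 p.2 := by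
          simpa only [inv_smul_smul] using X.smul_adj γ⁻¹ huv
        exact ⟨⟨⟨p, hadj⟩, hp⟩, Quot.sound ⟨γ, rfl⟩⟩

open Classical in
/-- The retraction of the vertices of `X` moving each translate `γ a` to `γ b`. -/
noncomputable def retract (X : GTree G) (a b : X.V) (x : X.V) : X.V :=
  if h : ∃ γ, X.smul γ a = x then X.smul h.choose b else x

/-- `a` can be pushed to `b`: the stabilizer of `a` fixes `b`, and `b` is not a translate
of `a`. -/
structure Pushable (X : GTree G) (a b : X.V) : Prop where
  stab_le : ∀ γ, X.smul γ a = a → X.smul γ b = b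
  ne : ∀ γ, X.smul γ a ≠ b

section retract

variable {X : GTree G} {a b : X.V}

theorem retract_of_not (x : X.V) (h : ¬∃ γ, X.smul γ a = x) : X.retract a b x = x := by
  rw [retract, dif_neg h]

theorem Pushable.retract_smul_self (h : X.Pushable a b) (γ : G) :
    X.retract a b (X.smul γ a) = X.smul γ b := by
  have hex : ∃ δ, X.smul δ a = X.smul γ a := ⟨γ, rfl⟩
  rw [retract, dif_pos hex]
  have h1 := h.stab_le (γ⁻¹ * hex.choose) (by
    rw [X.smul_mul, hex.choose_spec, inv_smul_smul])
  conv_rhs => rw [← h1]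
  rw [← X.smul_mul, mul_inv_cancel_left]

theorem Pushable.retract_not (h : X.Pushable a b) (x : X.V) :
    ¬∃ γ, X.smul γ a = X.retract a b x := by
  by_cases hx : ∃ γ, X.smul γ a = x
  · obtain ⟨γ, rfl⟩ := hx
    rw [h.retract_smul_self]
    rintro ⟨δ, hδ⟩
    refine h.ne (γ⁻¹ * δ) ?_
    rw [X.smul_mul, hδ, inv_smul_smul]
  · rwa [retract_of_not x hx]

theorem Pushable.equivariant_retract (h : X.Pushable a b) : Equivariant X X (X.retract a b) := by
  intro γ x
  by_cases hx : ∃ δ, X.smul δ a = x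
  · obtain ⟨δ, rfl⟩ := hx
    rw [← X.smul_mul, h.retract_smul_self, h.retract_smul_self, X.smul_mul]
  · rw [retract_of_not x hx, retract_of_not]
    rintro ⟨δ, hδ⟩
    exact hx ⟨γ⁻¹ * δ, by rw [X.smul_mul, hδ, inv_smul_smul]⟩

theorem Pushable.eqvGen_retract (h : X.Pushable a b) (u : X.V) :
    Relation.EqvGen (fun x y => ∃ γ : G, x = X.smul γ a ∧ y = X.smul γ b) u (X.retract a b u) := by
  by_cases hx : ∃ δ, X.smul δ a = u
  · obtain ⟨δ, rfl⟩ := hx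
    rw [h.retract_smul_self]
    exact .rel _ _ ⟨δ, rfl, rfl⟩
  · rw [retract_of_not u hx]
    exact .refl _

theorem Pushable.retract_eq_iff (h : X.Pushable a b) (u v : X.V) :
    X.retract a b u = X.retract a b v ↔
      Relation.EqvGen (fun x y => ∃ γ : G, x = X.smul γ a ∧ y = X.smul γ b) u v := by
  constructor
  · intro huv
    have := h.eqvGen_retract u
    rw [huv] at this
    exact this.trans _ _ _ ((h.eqvGen_retract v).symm _ _)
  · intro huv
    induction huv with
    | rel x y hxy =>
      obtain ⟨γ, rfl, rfl⟩ := hxy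
      rw [h.retract_smul_self, retract_of_not]
      rintro ⟨δ, hδ⟩
      exact h.ne (γ⁻¹ * δ) (by rw [X.smul_mul, hδ, inv_smul_smul])
    | refl => rfl
    | symm _ _ _ ih => exact ih.symm
    | trans _ _ _ _ _ ih₁ ih₂ => exact ih₁.trans ih₂

end retract

/-- The quotient graph collapsing all translates of the edge from `a` to `b`. -/
def collapseGraph (X : GTree G) (a b : X.V) :
    SimpleGraph {x : X.V // ¬∃ γ, X.smul γ a = x} where
  Adj x y := x ≠ y ∧ ∃ u v, X.graph.Adj u v ∧ X.retract a b u = x ∧ X.retract a b v = y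
  symm := ⟨fun _ _ ⟨hne, u, v, h, hu, hv⟩ => ⟨hne.symm, v, u, h.symm, hv, hu⟩⟩
  loopless := ⟨fun _ h => h.1 rfl⟩

theorem Pushable.exists_cut {X : GTree G} {a b : X.V} (h : X.Pushable a b)
    (hab : X.graph.Adj a b) {u v : X.V} (huv : X.graph.Adj u v)
    (hne : X.retract a b u ≠ X.retract a b v) :
    ∃ S : Set X.V, X.retract a b u ∈ S ∧ X.retract a b v ∉ S ∧
      (∀ x y, X.graph.Adj x y → X.retract a b x ∈ S → X.retract a b y ∉ S → x = u ∧ y = v) := by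
  obtain ⟨S, hu, hv, hS⟩ := X.isTree.exists_cut huv
  have key : ∀ γ, X.smul γ a ∈ S ↔ X.smul γ b ∈ S := by
    intro γ
    have hr : X.retract a b (X.smul γ a) = X.retract a b (X.smul γ b) :=
      (h.retract_eq_iff _ _).2 (.rel _ _ ⟨γ, rfl, rfl⟩)
    have hadj := X.smul_adj γ hab
    constructor <;> intro h1 <;> by_contra h2
    · obtain ⟨rfl, rfl⟩ := hS _ _ hadj h1 h2
      exact hne hr
    · obtain ⟨rfl, rfl⟩ := hS _ _ hadj.symm h1 h2
      exact hne hr.symm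
  have key' : ∀ x, X.retract a b x ∈ S ↔ x ∈ S := by
    intro x
    by_cases hx : ∃ δ, X.smul δ a = x
    · obtain ⟨δ, rfl⟩ := hx
      rw [h.retract_smul_self, key]
    · rw [retract_of_not x hx]
  refine ⟨S, (key' u).2 hu, mt (key' v).1 hv, fun x y hxy hx hy => ?_⟩
  exact hS x y hxy ((key' x).1 hx) (mt (key' y).2 hy)

theorem Pushable.isTree_collapseGraph {X : GTree G} {a b : X.V} (h : X.Pushable a b)
    (hab : X.graph.Adj a b) : (X.collapseGraph a b).IsTree := by
  refine SimpleGraph.Connected.isTree_of_exists_cut ?_ ?_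
  · refine X.isTree.connected.of_surjective (fun x => ⟨X.retract a b x, h.retract_not x⟩) ?_ ?_
    · rintro ⟨x, hx⟩
      exact ⟨x, Subtype.ext (retract_of_not x hx)⟩
    · intro u v huv
      by_cases he : X.retract a b u = X.retract a b v
      · simp only [he]; rfl
      · exact SimpleGraph.Adj.reachable
          ⟨fun h' => he (congrArg Subtype.val h'), u, v, huv, rfl, rfl⟩
  · rintro ⟨x, hx⟩ ⟨y, hy⟩ ⟨hne, u, v, huv, rfl, rfl⟩
    obtain ⟨S, hu, hv, hS⟩ := h.exists_cut hab huv fun h' => hne (Subtype.ext h')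
    refine ⟨{z | z.1 ∈ S}, hu, hv, ?_⟩
    rintro ⟨x', _⟩ ⟨y', _⟩ ⟨_, u', v', huv', rfl, rfl⟩ h1 h2
    obtain ⟨rfl, rfl⟩ := hS _ _ huv' h1 h2
    exact ⟨rfl, rfl⟩

theorem Pushable.not_inversion {X : GTree G} {a b : X.V} (h : X.Pushable a b)
    (hab : X.graph.Adj a b) {u v : X.V} (huv : X.graph.Adj u v)
    (hne : X.retract a b u ≠ X.retract a b v) (γ : G) :
    ¬(X.smul γ (X.retract a b u) = X.retract a b v ∧
      X.smul γ (X.retract a b v) = X.retract a b u) := by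
  rintro ⟨h1, h2⟩
  obtain ⟨S, hu, hv, hS⟩ := h.exists_cut hab huv hne
  rw [← h.equivariant_retract] at h1 h2
  obtain ⟨h3, h4⟩ := hS _ _ (X.smul_adj γ huv.symm) (by rwa [h2]) (by rwa [h1])
  exact X.no_inversions γ u v huv ⟨h4, h3⟩

/-- The tree obtained by collapsing all translates of the edge from `a` to `b`. -/
def collapseTree (X : GTree G) (a b : X.V) (h : X.Pushable a b) (hab : X.graph.Adj a b) :
    GTree G where
  V := {x : X.V // ¬∃ γ, X.smul γ a = x}
  graph := X.collapseGraph a b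
  isTree := h.isTree_collapseGraph hab
  smul γ x := ⟨X.smul γ x.1, fun ⟨δ, hδ⟩ => x.2 ⟨γ⁻¹ * δ, by
    rw [X.smul_mul, hδ, inv_smul_smul]⟩⟩
  smul_one x := Subtype.ext (X.smul_one _)
  smul_mul γ δ x := Subtype.ext (X.smul_mul _ _ _)
  smul_adj := by
    rintro γ ⟨x, hx⟩ ⟨y, hy⟩ ⟨hne, u, v, huv, rfl, rfl⟩
    refine ⟨fun h' => hne (Subtype.ext (X.smul_injective γ (congrArg Subtype.val h'))),
      X.smul γ u, X.smul γ v, X.smul_adj γ huv, ?_, ?_⟩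
    · exact h.equivariant_retract _ _
    · exact h.equivariant_retract _ _
  no_inversions := by
    rintro γ ⟨x, hx⟩ ⟨y, hy⟩ ⟨hne, u, v, huv, rfl, rfl⟩ ⟨h1, h2⟩
    exact h.not_inversion hab huv (fun h' => hne (Subtype.ext h')) γ
      ⟨congrArg Subtype.val h1, congrArg Subtype.val h2⟩

theorem Pushable.isCollapse {X : GTree G} {a b : X.V} (h : X.Pushable a b)
    (hab : X.graph.Adj a b) :
    IsCollapse X (X.collapseTree a b h hab) (fun x => ⟨X.retract a b x, h.retract_not x⟩)
      ⟨(a, b), hab⟩ := by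
  refine ⟨?_, h.ne, ?_, ?_, ?_, ?_⟩
  · exact inf_eq_left.2 h.stab_le
  · rintro ⟨x, hx⟩
    exact ⟨x, Subtype.ext (retract_of_not x hx)⟩
  · exact fun γ x => Subtype.ext (h.equivariant_retract γ x)
  · exact fun u v => Subtype.ext_iff.trans (h.retract_eq_iff u v)
  · rintro ⟨x, hx⟩ ⟨y, hy⟩ hne
    constructor
    · rintro ⟨_, u, v, huv, hu, hv⟩
      exact ⟨u, v, huv, Subtype.ext hu, Subtype.ext hv⟩
    · rintro ⟨u, v, huv, hu, hv⟩
      exact ⟨hne, u, v, huv, congrArg Subtype.val hu, congrArg Subtype.val hv⟩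

theorem IsCollapse.pushable {X Y : GTree G} {φ : X.V → Y.V} {e : X.Edge}
    (h : IsCollapse X Y φ e) : X.Pushable (d0 e) (d1 e) :=
  ⟨inf_eq_left.1 h.1, h.2.1⟩

theorem Collapse.sameEllipticSubgroups {X Y : GTree G} (h : Collapse X Y) :
    X.SameEllipticSubgroups Y := by
  obtain ⟨φ, e, h⟩ := h
  have hp := h.pushable
  obtain ⟨-, -, hsurj, heq, hfib, -⟩ := h
  rw [sameEllipticSubgroups_iff]
  refine ⟨⟨φ, heq⟩, ?_⟩
  choose s hs using hsurj
  have key : ∀ u v, φ u = φ v → X.retract (d0 e) (d1 e) u = X.retract (d0 e) (d1 e) v :=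
    fun u v huv => (hp.retract_eq_iff u v).2 ((hfib u v).1 huv)
  refine ⟨fun y => X.retract (d0 e) (d1 e) (s y), fun γ y => ?_⟩
  rw [← hp.equivariant_retract]
  exact key _ _ (by rw [hs, heq, hs])

theorem ElemDeformation.sameEllipticSubgroups {X Y : GTree G} (h : ElemDeformation X Y) :
    X.SameEllipticSubgroups Y := by
  induction h with
  | rel _ _ h => exact h.sameEllipticSubgroups
  | refl => exact fun _ => Iff.rfl
  | symm _ _ _ ih => exact fun H => (ih H).symm
  | trans _ _ _ _ _ ih₁ ih₂ => exact fun H => (ih₁ H).trans (ih₂ H)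

/-- Adjacent vertices with the same image under an equivariant map to `Y` whose point
stabilizers are elliptic in `X` span a collapsible edge, in one of the two directions. -/
theorem Equivariant.pushable_or {X Y : GTree G} {f : X.V → Y.V} (hf : Equivariant X Y f)
    {a b x : X.V} (hab : X.graph.Adj a b) (hfab : f a = f b)
    (hx : ∀ γ, Y.smul γ (f a) = f a → X.smul γ x = x) : X.Pushable a b ∨ X.Pushable b a := by
  have key : ∀ a b, X.graph.Adj a b → f a = f b →
      (∀ γ, Y.smul γ (f a) = f a → X.smul γ x = x) →
      X.graph.dist b x < X.graph.dist a x → X.Pushable a b := by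
    intro a b hab hfab hx hlt
    refine ⟨fun γ hγ => ?_, fun γ hγ => ?_⟩
    · have hxγ : X.smul γ x = x := hx γ (by rw [← hf, hγ])
      refine X.isTree.eq_of_adj_of_dist_lt (a := a) (x := x) ?_ hab ?_ hlt
      · simpa only [hγ] using X.smul_adj γ hab
      · have := X.dist_smul γ b x
        rw [hxγ] at this
        rwa [this]
    · have hxγ : X.smul γ x = x := hx γ (by rw [← hf, hγ, hfab])
      have := X.dist_smul γ a x
      rw [hxγ, hγ] at this
      omega
  have hne := X.isTree.dist_ne_of_adj x hab
  rw [X.graph.dist_comm, X.graph.dist_comm (u := x)] at hne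
  rcases lt_or_gt_of_ne hne with h | h
  · exact Or.inr (key b a hab.symm hfab.symm (by rwa [← hfab]) h)
  · exact Or.inl (key a b hab hfab hx h)

/-- `h : X → X'` is an equivariant quotient map of trees through which `f : X → Y` factors as
`f' ∘ h`. -/
structure IsQuotientOver {X X' Y : GTree G} (f : X.V → Y.V) (h : X.V → X'.V)
    (f' : X'.V → Y.V) : Prop where
  elem : ElemDeformation X X'
  equivariant : Equivariant X X' h
  equivariant' : Equivariant X' Y f'
  surjective : Function.Surjective h
  comp : ∀ x, f' (h x) = f x
  adj : ∀ u v, X.graph.Adj u v → h u = h v ∨ X'.graph.Adj (h u) (h v)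
  lift : ∀ a b, X'.graph.Adj a b → ∃ u v, X.graph.Adj u v ∧ h u = a ∧ h v = b

theorem IsQuotientOver.cocompact {X X' Y : GTree G} {f : X.V → Y.V} {h : X.V → X'.V}
    {f' : X'.V → Y.V} (hq : IsQuotientOver f h f') (hX : X.Cocompact) : X'.Cocompact := by
  rw [cocompact_iff] at hX ⊢
  obtain ⟨⟨F, hF, hF'⟩, E, hE, hE'⟩ := hX
  refine ⟨⟨h '' F, hF.image h, fun x => ?_⟩, Prod.map h h '' E, hE.image _, fun a b hab => ?_⟩
  · obtain ⟨x, rfl⟩ := hq.surjective x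
    obtain ⟨γ, y, hy, rfl⟩ := hF' x
    exact ⟨γ, h y, ⟨y, hy, rfl⟩, (hq.equivariant γ y).symm⟩
  · obtain ⟨u, v, huv, rfl, rfl⟩ := hq.lift a b hab
    obtain ⟨γ, p, hp, rfl, rfl⟩ := hE' u v huv
    exact ⟨γ, _, ⟨p, hp, rfl⟩, (hq.equivariant γ p.1).symm, (hq.equivariant γ p.2).symm⟩

theorem IsQuotientOver.trans {X X' X'' Y : GTree G} {f : X.V → Y.V} {h : X.V → X'.V}
    {f' : X'.V → Y.V} {h' : X'.V → X''.V} {f'' : X''.V → Y.V} (hq : IsQuotientOver f h f')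
    (hq' : IsQuotientOver f' h' f'') : IsQuotientOver f (h' ∘ h) f'' where
  elem := hq.elem.trans _ _ _ hq'.elem
  equivariant γ x := by simp only [Function.comp, hq.equivariant γ x, hq'.equivariant γ]
  equivariant' := hq'.equivariant'
  surjective := hq'.surjective.comp hq.surjective
  comp x := by simp only [Function.comp, hq'.comp, hq.comp]
  adj u v huv := by
    rcases hq.adj u v huv with h1 | h1
    · exact Or.inl (congrArg h' h1)
    · exact hq'.adj _ _ h1
  lift a b hab := by
    obtain ⟨u, v, huv, rfl, rfl⟩ := hq'.lift a b hab
    obtain ⟨u', v', huv', hu, hv⟩ := hq.lift _ _ huv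
    exact ⟨u', v', huv', congrArg h' hu, congrArg h' hv⟩

theorem IsQuotientOver.refl {X Y : GTree G} {f : X.V → Y.V} (hf : Equivariant X Y f) :
    IsQuotientOver f (X' := X) id f where
  elem := .refl _
  equivariant _ _ := rfl
  equivariant' := hf
  surjective := Function.surjective_id
  comp _ := rfl
  adj _ _ h := Or.inr h
  lift a b hab := ⟨a, b, hab, rfl, rfl⟩

theorem Pushable.isQuotientOver {X Y : GTree G} {f : X.V → Y.V} (hf : Equivariant X Y f)
    {a b : X.V} (h : X.Pushable a b) (hab : X.graph.Adj a b) (hfab : f a = f b) :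
    IsQuotientOver f (X' := X.collapseTree a b h hab)
      (fun x => ⟨X.retract a b x, h.retract_not x⟩) (fun x => f x.1) where
  elem := .rel _ _ ⟨_, _, h.isCollapse hab⟩
  equivariant γ x := (h.isCollapse hab).2.2.2.1 γ x
  equivariant' γ x := hf γ x.1
  surjective := (h.isCollapse hab).2.2.1
  comp x := by
    dsimp only
    by_cases hx : ∃ δ, X.smul δ a = x
    · obtain ⟨δ, rfl⟩ := hx
      rw [h.retract_smul_self, hf, hf, hfab]
    · rw [retract_of_not x hx]
  adj u v huv := or_iff_not_imp_left.2 fun hne => ⟨hne, u, v, huv, rfl, rfl⟩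
  lift x y hxy := by
    obtain ⟨_, u, v, huv, hu, hv⟩ := hxy
    exact ⟨u, v, huv, Subtype.ext hu, Subtype.ext hv⟩

/-- If the stabilizers of the points in the image of `f` are elliptic in `X`, then all the edges
of `X` that `f` collapses can be collapsed by an elementary deformation. -/
theorem Equivariant.exists_isQuotientOver {X Y : GTree G} {f : X.V → Y.V}
    (hf : Equivariant X Y f) (hX : X.Cocompact)
    (hfix : ∀ x, ∃ x', ∀ γ, Y.smul γ (f x) = f x → X.smul γ x' = x') :
    ∃ (X' : GTree G) (h : X.V → X'.V) (f' : X'.V → Y.V), IsQuotientOver f h f' ∧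
      ∀ a b, X'.graph.Adj a b → f' a ≠ f' b := by
  obtain ⟨⟨F, hF, hF'⟩, -⟩ := (cocompact_iff X).1 hX
  obtain ⟨n, hn⟩ : ∃ n, hF.toFinset.card ≤ n := ⟨_, le_rfl⟩
  have hF'' : ∀ x, ∃ γ, ∃ y ∈ hF.toFinset, X.smul γ y = x := by simpa using hF'
  generalize hF.toFinset = F₀ at hn hF''
  clear hF hF' F hX
  induction n generalizing X with
  | zero =>
    obtain ⟨x⟩ := X.isTree.connected.nonempty
    obtain ⟨_, y, hy, _⟩ := hF'' x
    rw [Finset.card_eq_zero.1 (Nat.le_zero.1 hn)] at hy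
    simp at hy
  | succ n ih =>
    by_cases hz : ∀ a b, X.graph.Adj a b → f a ≠ f b
    · exact ⟨X, id, f, .refl hf, hz⟩
    obtain ⟨a, b, hab, hfab, hp⟩ : ∃ a b, X.graph.Adj a b ∧ f a = f b ∧ X.Pushable a b := by
      push Not at hz
      obtain ⟨a, b, hab, hfab⟩ := hz
      obtain ⟨x, hx⟩ := hfix a
      rcases hf.pushable_or hab hfab hx with h | h
      · exact ⟨a, b, hab, hfab, h⟩
      · exact ⟨b, a, hab.symm, hfab.symm, h⟩
    have hq := hp.isQuotientOver hf hab hfab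
    classical
    obtain ⟨X'', h', f'', hq', hz'⟩ := ih hq.equivariant'
      (F₀ := F₀.subtype fun x => ¬∃ γ, X.smul γ a = x) (by
        rintro ⟨x, hx⟩
        obtain ⟨x', hx'⟩ := hfix x
        refine ⟨⟨X.retract a b x', hp.retract_not x'⟩, fun γ hγ => ?_⟩
        rw [← hq.equivariant, hx' γ hγ]) (by
        refine (Finset.card_subtype _ _).trans_le ?_
        obtain ⟨γ, y, hy, hya⟩ := hF'' a
        have : (F₀.filter fun x => ¬∃ γ, X.smul γ a = x).card < F₀.card := by
          refine Finset.card_lt_card (Finset.filter_ssubset.2 ⟨y, hy, ?_⟩)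
          rw [not_not]
          exact ⟨γ⁻¹, by rw [← hya, inv_smul_smul]⟩
        omega) (by
        rintro ⟨x, hx⟩
        obtain ⟨γ, y, hy, rfl⟩ := hF'' x
        have hy' : ¬∃ γ, X.smul γ a = y := fun ⟨δ, hδ⟩ =>
          hx ⟨γ * δ, by rw [X.smul_mul, hδ]⟩
        exact ⟨γ, ⟨y, hy'⟩, Finset.mem_subtype.2 hy, rfl⟩)
    exact ⟨X'', _, f'', hq.trans hq', hz'⟩

/-- Data for blowing up the vertices of `X` to stars: new vertices `N`, each joined by a hair to
the vertex `q a` of `X`, and, for each edge from `v` to `u`, the vertex `att v u` of the star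
of `v` to which this edge is attached. -/
structure StarData (X : GTree G) where
  N : Type u
  smul : G → N → N
  smul_one : ∀ a, smul 1 a = a
  smul_mul : ∀ γ δ a, smul (γ * δ) a = smul γ (smul δ a)
  q : N → X.V
  q_smul : ∀ γ a, q (smul γ a) = X.smul γ (q a)
  att : X.V → X.V → X.V ⊕ N
  att_over : ∀ v u, X.graph.Adj v u → Sum.elim id q (att v u) = v
  att_smul : ∀ γ v u, X.graph.Adj v u →
    att (X.smul γ v) (X.smul γ u) = Sum.map (X.smul γ) (smul γ) (att v u)

namespace StarData

variable {X : GTree G} (D : StarData X)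

/-- The projection of the blow-up to `X`. -/
def proj : X.V ⊕ D.N → X.V := Sum.elim id D.q

/-- The underlying graph of the blow-up. -/
def graph : SimpleGraph (X.V ⊕ D.N) where
  Adj z z' := (∃ a, z = .inr a ∧ z' = .inl (D.q a)) ∨ (∃ a, z' = .inr a ∧ z = .inl (D.q a)) ∨
    ∃ u v, X.graph.Adj u v ∧ z = D.att u v ∧ z' = D.att v u
  symm := ⟨by
    rintro z z' (h | h | ⟨u, v, h, rfl, rfl⟩)
    · exact Or.inr (Or.inl h)
    · exact Or.inl h
    · exact Or.inr (Or.inr ⟨v, u, h.symm, rfl, rfl⟩)⟩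
  loopless := ⟨by
    rintro z (⟨a, rfl, h⟩ | ⟨a, rfl, h⟩ | ⟨u, v, h, rfl, h'⟩)
    · cases h
    · cases h
    · have := congrArg (Sum.elim id D.q) h'
      rw [D.att_over _ _ h, D.att_over _ _ h.symm] at this
      exact h.ne this⟩

variable {D}

theorem proj_att {u v : X.V} (h : X.graph.Adj u v) : D.proj (D.att u v) = u :=
  D.att_over u v h

theorem adj_hair (a : D.N) : D.graph.Adj (.inr a) (.inl (D.q a)) := Or.inl ⟨a, rfl, rfl⟩

theorem adj_att {u v : X.V} (h : X.graph.Adj u v) : D.graph.Adj (D.att u v) (D.att v u) :=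
  Or.inr (Or.inr ⟨u, v, h, rfl, rfl⟩)

theorem adj_cases {z z' : X.V ⊕ D.N} (h : D.graph.Adj z z') : D.proj z = D.proj z' ∨
    ∃ u v, X.graph.Adj u v ∧ z = D.att u v ∧ z' = D.att v u := by
  rcases h with ⟨a, rfl, rfl⟩ | ⟨a, rfl, rfl⟩ | h
  · exact Or.inl rfl
  · exact Or.inl rfl
  · exact Or.inr h

theorem exists_cut_att {u v : X.V} (h : X.graph.Adj u v) :
    ∃ S : Set (X.V ⊕ D.N), D.att u v ∈ S ∧ D.att v u ∉ S ∧
      ∀ a b, D.graph.Adj a b → a ∈ S → b ∉ S → a = D.att u v ∧ b = D.att v u := by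
  obtain ⟨S, hu, hv, hS⟩ := X.isTree.exists_cut h
  refine ⟨D.proj ⁻¹' S, ?_, ?_, fun z z' hz hzS hzS' => ?_⟩
  · rwa [Set.mem_preimage, proj_att h]
  · rwa [Set.mem_preimage, proj_att h.symm]
  rcases adj_cases hz with h' | ⟨u', v', h', rfl, rfl⟩
  · rw [Set.mem_preimage] at hzS hzS'
    exact absurd (h' ▸ hzS) hzS'
  · rw [Set.mem_preimage, proj_att h'] at hzS
    rw [Set.mem_preimage, proj_att h'.symm] at hzS'
    obtain ⟨rfl, rfl⟩ := hS _ _ h' hzS hzS'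
    exact ⟨rfl, rfl⟩

theorem exists_cut_hair (a : D.N) :
    ∃ S : Set (X.V ⊕ D.N), .inr a ∈ S ∧ .inl (D.q a) ∉ S ∧
      ∀ z z', D.graph.Adj z z' → z ∈ S → z' ∉ S → z = .inr a ∧ z' = .inl (D.q a) := by
  choose S hS hS' hcut using fun u (h : X.graph.Adj (D.q a) u) => X.isTree.exists_cut h.symm
  refine ⟨{z | z = .inr a ∨ ∃ u, ∃ h : X.graph.Adj (D.q a) u,
    D.att (D.q a) u = .inr a ∧ D.proj z ∈ S u h}, Or.inl rfl, ?_, ?_⟩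
  · rintro (h | ⟨u, h, -, h'⟩)
    · cases h
    · exact hS' u h h'
  rintro z z' hz hzS hzS'
  rcases hzS with rfl | ⟨u, h, h', hzS⟩
  · rcases hz with ⟨b, h, rfl⟩ | ⟨b, _, h⟩ | ⟨u, v, h, h', rfl⟩
    · obtain rfl := Sum.inr.inj h
      exact ⟨rfl, rfl⟩
    · cases h
    · obtain rfl : D.q a = u := by rw [← proj_att (D := D) h, ← h']; rfl
      exact absurd (Or.inr ⟨v, h, h'.symm, by rw [proj_att h.symm]; exact hS v h⟩) hzS'
  · rcases adj_cases hz with h1 | ⟨u', v', h1, rfl, rfl⟩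
    · exact absurd (Or.inr ⟨u, h, h', by rwa [← h1]⟩) hzS'
    · rw [proj_att h1] at hzS
      by_cases hv' : v' ∈ S u h
      · exact absurd (Or.inr ⟨u, h, h', by rwa [proj_att h1.symm]⟩) hzS'
      · obtain ⟨rfl, rfl⟩ := hcut u h _ _ h1 hzS hv'
        exact absurd (Or.inl h') hzS'

theorem reachable_inl_proj (z : X.V ⊕ D.N) : D.graph.Reachable z (.inl (D.proj z)) := by
  rcases z with x | a
  · rfl
  · exact (adj_hair a).reachable

variable (D) in
theorem connected_graph : D.graph.Connected := by
  have key : ∀ u v, X.graph.Reachable u v → D.graph.Reachable (.inl u) (.inl v) := by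
    rintro u v ⟨p⟩
    induction p with
    | nil => rfl
    | @cons u v _ h _ ih =>
      have h1 := reachable_inl_proj (D := D) (D.att u v)
      have h2 := reachable_inl_proj (D := D) (D.att v u)
      rw [proj_att h] at h1
      rw [proj_att h.symm] at h2
      exact h1.symm.trans ((adj_att h).reachable.trans (h2.trans ih))
  have : Nonempty X.V := X.isTree.connected.nonempty
  refine ⟨fun z z' => ?_⟩
  exact (reachable_inl_proj z).trans ((key _ _ (X.isTree.connected _ _)).trans
    (reachable_inl_proj z').symm)

variable (D) in
theorem isTree_graph : D.graph.IsTree := by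
  refine D.connected_graph.isTree_of_exists_cut ?_
  rintro z z' (⟨a, rfl, rfl⟩ | ⟨a, rfl, rfl⟩ | ⟨u, v, h, rfl, rfl⟩)
  · exact exists_cut_hair a
  · obtain ⟨S, h1, h2, h3⟩ := exists_cut_hair a
    exact ⟨Sᶜ, h2, fun h => h h1, fun z z' h hz hz' =>
      (h3 _ _ h.symm (not_not.1 hz') hz).symm⟩
  · exact exists_cut_att h

variable (D) in
/-- The blow-up of `X` given by `D`. -/
def tree : GTree G where
  V := X.V ⊕ D.N
  graph := D.graph
  isTree := D.isTree_graph
  smul γ := Sum.map (X.smul γ) (D.smul γ)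
  smul_one := by rintro (x | a) <;> simp [X.smul_one, D.smul_one]
  smul_mul := by rintro γ δ (x | a) <;> simp [X.smul_mul, D.smul_mul]
  smul_adj := by
    rintro γ z z' (⟨a, rfl, rfl⟩ | ⟨a, rfl, rfl⟩ | ⟨u, v, h, rfl, rfl⟩)
    · exact Or.inl ⟨D.smul γ a, rfl, by simp [D.q_smul]⟩
    · exact Or.inr (Or.inl ⟨D.smul γ a, rfl, by simp [D.q_smul]⟩)
    · rw [← D.att_smul γ u v h, ← D.att_smul γ v u h.symm]
      exact adj_att (X.smul_adj γ h)
  no_inversions := by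
    rintro γ z z' (⟨a, rfl, rfl⟩ | ⟨a, rfl, rfl⟩ | ⟨u, v, h, rfl, rfl⟩) ⟨h1, h2⟩
    · cases h1
    · cases h1
    · rw [← D.att_smul γ u v h] at h1
      rw [← D.att_smul γ v u h.symm] at h2
      refine X.no_inversions γ u v h ⟨?_, ?_⟩
      · rw [← proj_att (D := D) (X.smul_adj γ h), h1, proj_att h.symm]
      · rw [← proj_att (D := D) (X.smul_adj γ h.symm), h2, proj_att h]

theorem equivariant_proj : Equivariant D.tree X D.proj := by
  rintro γ (x | a)
  · rfl
  · exact D.q_smul γ a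

theorem cocompact_tree (hX : X.Cocompact)
    (hN : ∃ F : Set D.N, F.Finite ∧ ∀ a, ∃ γ, ∃ b ∈ F, D.smul γ b = a) : D.tree.Cocompact := by
  rw [cocompact_iff] at hX ⊢
  obtain ⟨⟨F, hF, hF'⟩, E, hE, hE'⟩ := hX
  obtain ⟨K, hK, hK'⟩ := hN
  refine ⟨⟨Sum.inl '' F ∪ Sum.inr '' K, (hF.image _).union (hK.image _), ?_⟩,
    (fun a => (.inr a, .inl (D.q a))) '' K ∪ (fun a => (.inl (D.q a), .inr a)) '' K ∪
      (fun p => (D.att p.1 p.2, D.att p.2 p.1)) '' E,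
    ((hK.image _).union (hK.image _)).union (hE.image _), ?_⟩
  · rintro (x | a)
    · obtain ⟨γ, y, hy, rfl⟩ := hF' x
      exact ⟨γ, .inl y, Or.inl ⟨y, hy, rfl⟩, rfl⟩
    · obtain ⟨γ, b, hb, rfl⟩ := hK' a
      exact ⟨γ, .inr b, Or.inr ⟨b, hb, rfl⟩, rfl⟩
  · rintro z z' (⟨a, rfl, rfl⟩ | ⟨a, rfl, rfl⟩ | ⟨u, v, h, rfl, rfl⟩)
    · obtain ⟨γ, b, hb, rfl⟩ := hK' a
      exact ⟨γ, _, Or.inl (Or.inl ⟨b, hb, rfl⟩), rfl, congrArg Sum.inl (D.q_smul γ b).symm⟩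
    · obtain ⟨γ, b, hb, rfl⟩ := hK' a
      exact ⟨γ, _, Or.inl (Or.inr ⟨b, hb, rfl⟩), congrArg Sum.inl (D.q_smul γ b).symm, rfl⟩
    · obtain ⟨γ, p, hp, rfl, rfl⟩ := hE' u v h
      have hadj : X.graph.Adj p.1 p.2 := by
        simpa [inv_smul_smul] using X.smul_adj γ⁻¹ h
      exact ⟨γ, _, Or.inr ⟨p, hp, rfl⟩, (D.att_smul γ _ _ hadj).symm,
        (D.att_smul γ _ _ hadj.symm).symm⟩

end StarData

/-- The star data adding a single orbit of hairs, at the orbit of `x₀`. -/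
def hairData (X : GTree G) (x₀ : X.V) : StarData X where
  N := {x : X.V // ∃ γ, X.smul γ x₀ = x}
  smul γ x := ⟨X.smul γ x.1, x.2.imp' (γ * ·) fun δ h => by rw [X.smul_mul, h]⟩
  smul_one x := Subtype.ext (X.smul_one _)
  smul_mul γ δ x := Subtype.ext (X.smul_mul _ _ _)
  q := Subtype.val
  q_smul _ _ := rfl
  att v _ := .inl v
  att_over _ _ _ := rfl
  att_smul _ _ _ _ := rfl

theorem IsGIso.isCollapse_hairData {X Y : GTree G} {φ : X.V → Y.V} (h : IsGIso X Y φ) (x₀ : X.V) :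
    IsCollapse (X.hairData x₀).tree Y (φ ∘ (X.hairData x₀).proj)
      ⟨(.inr ⟨x₀, 1, X.smul_one x₀⟩, .inl x₀), StarData.adj_hair _⟩ := by
  obtain ⟨⟨hinj, hsurj⟩, hadj, heq⟩ := h
  refine ⟨inf_eq_left.2 fun γ hγ => ?_, fun γ hγ => (by cases hγ), fun y => ?_, fun γ z => ?_,
    fun z z' => ?_, fun a b hab => ?_⟩
  · have := congrArg (X.hairData x₀).proj hγ
    exact congrArg Sum.inl this
  · obtain ⟨x, rfl⟩ := hsurj y
    exact ⟨.inl x, rfl⟩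
  · exact (congrArg φ (StarData.equivariant_proj γ z)).trans (heq _ _)
  · constructor
    · intro hz
      have key : ∀ z : X.V ⊕ (X.hairData x₀).N, Relation.EqvGen (fun a b => ∃ γ : G,
          a = (X.hairData x₀).tree.smul γ (.inr ⟨x₀, 1, X.smul_one x₀⟩) ∧
          b = (X.hairData x₀).tree.smul γ (.inl x₀)) z (.inl ((X.hairData x₀).proj z)) := by
        rintro (x | ⟨x, γ, rfl⟩)
        · exact .refl _
        · exact .rel _ _ ⟨γ, rfl, rfl⟩
      have hz' : (X.hairData x₀).proj z = (X.hairData x₀).proj z' := hinj hz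
      have h1 := key z
      rw [hz'] at h1
      exact h1.trans _ _ _ ((key z').symm _ _)
    · intro hz
      induction hz with
      | rel _ _ h =>
        obtain ⟨γ, rfl, rfl⟩ := h
        rfl
      | refl => rfl
      | symm _ _ _ ih => exact ih.symm
      | trans _ _ _ _ _ ih₁ ih₂ => exact ih₁.trans ih₂
  · constructor
    · obtain ⟨x, rfl⟩ := hsurj a
      obtain ⟨y, rfl⟩ := hsurj b
      intro h
      exact ⟨.inl x, .inl y, StarData.adj_att (D := X.hairData x₀) ((hadj _ _).2 h), rfl, rfl⟩
    · rintro ⟨z, z', hz, rfl, rfl⟩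
      rcases StarData.adj_cases hz with h | ⟨u, v, h, rfl, rfl⟩
      · exact absurd (congrArg φ h) hab
      · exact (hadj _ _).1 h

theorem IsGIso.elemDeformation {X Y : GTree G} {φ : X.V → Y.V} (h : IsGIso X Y φ) :
    ElemDeformation X Y := by
  obtain ⟨x₀⟩ := X.isTree.connected.nonempty
  have hid : IsGIso X X id := ⟨Function.bijective_id, fun _ _ => Iff.rfl, fun _ _ => rfl⟩
  exact ((Relation.EqvGen.rel _ _ ⟨_, _, hid.isCollapse_hairData x₀⟩).symm _ _).trans _ _ _
    (.rel _ _ ⟨_, _, h.isCollapse_hairData x₀⟩)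

theorem Equivariant.isGIso {X Y : GTree G} {f : X.V → Y.V} (hf : Equivariant X Y f)
    (hb : Function.Bijective f) (hadj : ∀ u v, X.graph.Adj u v → Y.graph.Adj (f u) (f v)) :
    IsGIso X Y f := by
  refine ⟨hb, fun u v => ⟨hadj u v, fun h => ?_⟩, hf⟩
  obtain ⟨p, hp⟩ := (X.isTree.connected u v).exists_isPath
  let F : X.graph →g Y.graph := ⟨f, fun {a b} h => hadj a b h⟩
  have hp' : (p.map F).IsPath := hp.map hb.1
  have h2 : (h.toWalk).IsPath := by simp [SimpleGraph.Adj.toWalk, h.ne]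
  have h1 := congrArg SimpleGraph.Walk.length
    (congrArg Subtype.val ((Y.isTree.isAcyclic.subsingleton_path _ _).elim ⟨_, hp'⟩ ⟨_, h2⟩))
  simp only [SimpleGraph.Walk.length_map, SimpleGraph.Adj.toWalk, SimpleGraph.Walk.length_cons,
    SimpleGraph.Walk.length_nil] at h1
  exact SimpleGraph.Walk.adj_of_length_eq_one h1

theorem StarData.elemDeformation_tree {X : GTree G} {D : StarData X} (hD : D.tree.Cocompact) :
    ElemDeformation D.tree X := by
  obtain ⟨X', h, f', hq, hz⟩ := (equivariant_proj (D := D)).exists_isQuotientOver hD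
    fun z => ⟨.inl (D.proj z), fun γ hγ => congrArg Sum.inl hγ⟩
  have key : ∀ z : X.V ⊕ D.N, h z = h (.inl (D.proj z)) := by
    rintro (x | a)
    · rfl
    · refine (hq.adj _ _ (adj_hair a)).resolve_right fun hadj => hz _ _ hadj ?_
      exact (hq.comp _).trans (hq.comp (.inl (D.q a))).symm
  refine hq.elem.trans _ _ _ (hq.equivariant'.isGIso ⟨fun a b hab => ?_, fun x => ?_⟩
    fun a b hab => ?_).elemDeformation
  · obtain ⟨z, rfl⟩ := hq.surjective a
    obtain ⟨z', rfl⟩ := hq.surjective b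
    rw [hq.comp, hq.comp] at hab
    rw [key z, key z', hab]
  · exact ⟨h (.inl x), hq.comp _⟩
  · have hne := hz a b hab
    obtain ⟨z, z', hzz', rfl, rfl⟩ := hq.lift a b hab
    rw [hq.comp, hq.comp] at hne ⊢
    rcases adj_cases hzz' with h' | ⟨u, v, h', rfl, rfl⟩
    · exact absurd h' hne
    · rwa [proj_att h', proj_att h'.symm]

/-- Every `G`-tree has an invariant orientation. -/
theorem exists_orientation (Y : GTree G) : ∃ P : Y.V → Y.V → Prop,
    (∀ γ a b, P (Y.smul γ a) (Y.smul γ b) ↔ P a b) ∧ (∀ a b, P a b → ¬P b a) ∧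
      ∀ a b, Y.graph.Adj a b → P a b ∨ P b a := by
  let S : Setoid (Y.V × Y.V) :=
    { r := fun p p' => ∃ γ, Y.smul γ p.1 = p'.1 ∧ Y.smul γ p.2 = p'.2
      iseqv := by
        refine ⟨fun p => ⟨1, Y.smul_one _, Y.smul_one _⟩, ?_, ?_⟩
        · rintro ⟨a, b⟩ ⟨_, _⟩ ⟨γ, rfl, rfl⟩
          exact ⟨γ⁻¹, Y.inv_smul_smul _ _, Y.inv_smul_smul _ _⟩
        · rintro ⟨a, b⟩ ⟨_, _⟩ ⟨_, _⟩ ⟨γ, rfl, rfl⟩ ⟨δ, rfl, rfl⟩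
          exact ⟨δ * γ, Y.smul_mul _ _ _, Y.smul_mul _ _ _⟩ }
  let m : Y.V → Y.V → Quotient S := fun a b => Quotient.mk S (a, b)
  have hm : ∀ γ a b, m (Y.smul γ a) (Y.smul γ b) = m a b := fun γ a b =>
    (Quotient.sound ⟨γ, rfl, rfl⟩ : m a b = _).symm
  refine ⟨fun a b => WellOrderingRel (m a b) (m b a), fun γ a b => ?_, fun a b h => ?_,
    fun a b hab => ?_⟩
  · simp only [hm]
  · exact asymm_of WellOrderingRel h
  · rcases trichotomous_of WellOrderingRel (m a b) (m b a) with h | h | h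
    · exact Or.inl h
    · obtain ⟨γ, h1, h2⟩ := Quotient.exact h
      exact absurd ⟨h1, h2⟩ (Y.no_inversions γ a b hab)
    · exact Or.inr h

open Classical in
/-- The vertex following `y` on the geodesic from `y` to `y'`. -/
noncomputable def step (Y : GTree G) (y y' : Y.V) : Y.V :=
  if h : y = y' then y else (Y.isTree.connected.exists_adj_dist h).choose

theorem step_self (Y : GTree G) (y : Y.V) : Y.step y y = y := dif_pos rfl

theorem step_spec (Y : GTree G) {y y' : Y.V} (h : y ≠ y') : Y.graph.Adj y (Y.step y y') ∧
    Y.graph.dist (Y.step y y') y' + 1 = Y.graph.dist y y' := by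
  rw [step, dif_neg h]
  exact (Y.isTree.connected.exists_adj_dist h).choose_spec

theorem step_smul (Y : GTree G) (γ : G) (y y' : Y.V) :
    Y.step (Y.smul γ y) (Y.smul γ y') = Y.smul γ (Y.step y y') := by
  by_cases h : y = y'
  · rw [h, step_self, step_self]
  have h1 := Y.step_spec h
  have h2 := Y.step_spec ((Y.smul_injective γ).ne h)
  refine Y.isTree.eq_of_adj_of_dist_lt h2.1 (Y.smul_adj γ h1.1) (Nat.lt_of_succ_le h2.2.le) ?_
  rw [dist_smul, dist_smul]
  exact Nat.lt_of_succ_le h1.2.le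

section foldData

variable {X Y : GTree G} {R : X.V → X.V → Prop} {s : X.V → X.V → Y.V}

open Classical in
/-- The blow-up of `X` in which the edges starting at `v` in a direction `u` with `R v u` are
attached to a new vertex depending only on `v` and `s v u`. -/
noncomputable def foldData (hR : ∀ γ v u, R (X.smul γ v) (X.smul γ u) ↔ R v u)
    (hs : ∀ γ v u, s (X.smul γ v) (X.smul γ u) = Y.smul γ (s v u)) : StarData X where
  N := {p : X.V × Y.V // ∃ u, X.graph.Adj p.1 u ∧ R p.1 u ∧ s p.1 u = p.2}
  smul γ p := ⟨(X.smul γ p.1.1, Y.smul γ p.1.2), by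
    obtain ⟨u, h, hvu, hu⟩ := p.2
    exact ⟨X.smul γ u, X.smul_adj γ h, (hR _ _ _).2 hvu, (hs _ _ _).trans (congrArg _ hu)⟩⟩
  smul_one p := Subtype.ext (Prod.ext (X.smul_one _) (Y.smul_one _))
  smul_mul γ δ p := Subtype.ext (Prod.ext (X.smul_mul _ _ _) (Y.smul_mul _ _ _))
  q p := p.1.1
  q_smul _ _ := rfl
  att v u := if h : X.graph.Adj v u ∧ R v u then .inr ⟨(v, s v u), u, h.1, h.2, rfl⟩ else .inl v
  att_over v u _ := by split_ifs <;> rfl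
  att_smul γ v u h := by
    by_cases hvu : R v u
    · rw [dif_pos ⟨X.smul_adj γ h, (hR _ _ _).2 hvu⟩, dif_pos ⟨h, hvu⟩]
      exact congrArg Sum.inr (Subtype.ext (Prod.ext rfl (hs _ _ _)))
    · rw [dif_neg fun h' => hvu ((hR γ v u).1 h'.2), dif_neg fun h' => hvu h'.2]
      rfl

variable {hR : ∀ γ v u, R (X.smul γ v) (X.smul γ u) ↔ R v u}
  {hs : ∀ γ v u, s (X.smul γ v) (X.smul γ u) = Y.smul γ (s v u)}

theorem foldData_att_of {v u : X.V} (h : X.graph.Adj v u) (hvu : R v u) :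
    (foldData hR hs).att v u = .inr ⟨(v, s v u), u, h, hvu, rfl⟩ := dif_pos ⟨h, hvu⟩

theorem foldData_att_of_not {v u : X.V} (hvu : ¬R v u) :
    (foldData hR hs).att v u = .inl v := dif_neg fun h => hvu h.2

theorem foldData_adj (hasymm : ∀ v u, R v u → ¬R u v) {v u : X.V} (h : X.graph.Adj v u)
    (hvu : R v u) : (foldData hR hs).graph.Adj ((foldData hR hs).att v u) (.inl u) := by
  have := StarData.adj_att (D := foldData hR hs) h
  rwa [foldData_att_of_not (hasymm _ _ hvu)] at this

theorem foldData_adj' {v u : X.V} (h : X.graph.Adj v u) (hvu : R v u) :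
    (foldData hR hs).graph.Adj ((foldData hR hs).att v u) (.inl v) := by
  rw [foldData_att_of h hvu]
  exact StarData.adj_hair _

theorem foldData_forall_adj (hasymm : ∀ v u, R v u → ¬R u v)
    (htot : ∀ v u, X.graph.Adj v u → R v u ∨ R u v)
    {p : X.V ⊕ (foldData hR hs).N → X.V ⊕ (foldData hR hs).N → Prop}
    (hp : ∀ z z', p z z' → p z' z)
    (h₁ : ∀ v u, X.graph.Adj v u → R v u → p ((foldData hR hs).att v u) (.inl v))
    (h₂ : ∀ v u, X.graph.Adj v u → R v u → p ((foldData hR hs).att v u) (.inl u))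
    {z z'} (h : (foldData hR hs).graph.Adj z z') : p z z' := by
  have key : ∀ a : (foldData hR hs).N, p (.inr a) (.inl ((foldData hR hs).q a)) := by
    rintro ⟨⟨v, y⟩, u, h, hvu, hy⟩
    dsimp only at h hvu hy
    subst hy
    have := h₁ v u h hvu
    rwa [foldData_att_of h hvu] at this
  rcases h with ⟨a, rfl, rfl⟩ | ⟨a, rfl, rfl⟩ | ⟨u, v, h, rfl, rfl⟩
  · exact key a
  · exact hp _ _ (key a)
  · rcases htot u v h with huv | hvu
    · have := h₂ u v h huv
      rwa [foldData_att_of_not (hasymm _ _ huv)]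
    · have := hp _ _ (h₂ v u h.symm hvu)
      rwa [foldData_att_of_not (v := u) (hasymm _ _ hvu)]

theorem foldData_finite (hX : X.Cocompact) : ∃ F : Set (foldData hR hs).N,
    F.Finite ∧ ∀ a, ∃ γ, ∃ b ∈ F, (foldData hR hs).smul γ b = a := by
  obtain ⟨-, E, hE, hE'⟩ := (cocompact_iff X).1 hX
  refine ⟨Subtype.val ⁻¹' ((fun p => (p.1, s p.1 p.2)) '' E),
    (hE.image _).preimage Subtype.val_injective.injOn, ?_⟩
  rintro ⟨⟨v, y⟩, u, h, hvu, hy⟩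
  dsimp only at h hvu hy
  subst hy
  obtain ⟨γ, ⟨v, u⟩, hp, rfl, rfl⟩ := hE' v u h
  refine ⟨γ, ⟨(v, s v u), u, ?_, (hR _ _ _).1 hvu, rfl⟩, ⟨_, hp, rfl⟩,
    Subtype.ext (Prod.ext rfl (hs _ _ _).symm)⟩
  simpa [inv_smul_smul] using X.smul_adj γ⁻¹ h

/-- The natural extension of `f : X → Y` to the blow-up. -/
def foldMap (hR : ∀ γ v u, R (X.smul γ v) (X.smul γ u) ↔ R v u)
    (hs : ∀ γ v u, s (X.smul γ v) (X.smul γ u) = Y.smul γ (s v u)) (f : X.V → Y.V) :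
    X.V ⊕ (foldData hR hs).N → Y.V :=
  Sum.elim f fun p => p.1.2

theorem foldMap_att {f : X.V → Y.V} {v u : X.V} (h : X.graph.Adj v u) (hvu : R v u) :
    foldMap hR hs f ((foldData hR hs).att v u) = s v u := by
  rw [foldData_att_of h hvu]
  rfl

end foldData

/-- `f : X → Y` is an equivariant map, where `X` is a cocompact tree related to `X₀` by an
elementary deformation and has the same elliptic subgroups as `Y`. -/
structure Admissible (X₀ X Y : GTree G) (f : X.V → Y.V) : Prop where
  elem : ElemDeformation X₀ X
  cocompact : X.Cocompact
  same : X.SameEllipticSubgroups Y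
  equivariant : Equivariant X Y f

namespace Admissible

variable {X₀ X Y : GTree G} {f : X.V → Y.V}

theorem tree (hA : Admissible X₀ X Y f) (D : StarData X)
    (hN : ∃ F : Set D.N, F.Finite ∧ ∀ a, ∃ γ, ∃ b ∈ F, D.smul γ b = a) {F : D.N → Y.V}
    (hF : ∀ γ a, F (D.smul γ a) = Y.smul γ (F a)) : Admissible X₀ D.tree Y (Sum.elim f F) := by
  have hc := StarData.cocompact_tree hA.cocompact hN
  have hD := StarData.elemDeformation_tree hc
  refine ⟨hA.elem.trans _ _ _ (hD.symm _ _), hc,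
    fun H => (hD.sameEllipticSubgroups H).trans (hA.same H), ?_⟩
  rintro γ (x | a)
  · exact hA.equivariant γ x
  · exact hF γ a

theorem exists_quotient (hA : Admissible X₀ X Y f) :
    ∃ (X' : GTree G) (h : X.V → X'.V) (f' : X'.V → Y.V), Admissible X₀ X' Y f' ∧
      IsQuotientOver f h f' ∧ ∀ a b, X'.graph.Adj a b → f' a ≠ f' b := by
  obtain ⟨-, g, hg⟩ := (sameEllipticSubgroups_iff X Y).1 hA.same
  obtain ⟨X', h, f', hq, hz⟩ := hA.equivariant.exists_isQuotientOver hA.cocompact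
    fun x => ⟨g (f x), fun γ hγ => by rw [← hg, hγ]⟩
  exact ⟨X', h, f', ⟨hA.elem.trans _ _ _ hq.elem, hq.cocompact hA.cocompact,
    fun H => (hq.elem.sameEllipticSubgroups H).symm.trans (hA.same H), hq.equivariant'⟩, hq, hz⟩

theorem exists_surjective (hA : Admissible X₀ X Y f) (hY : Y.Cocompact) :
    ∃ (X' : GTree G) (f' : X'.V → Y.V), Admissible X₀ X' Y f' ∧ Function.Surjective f' := by
  obtain ⟨-, g, hg⟩ := (sameEllipticSubgroups_iff X Y).1 hA.same
  let D : StarData X :=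
    { N := Y.V
      smul := Y.smul
      smul_one := Y.smul_one
      smul_mul := Y.smul_mul
      q := g
      q_smul := hg
      att := fun v _ => .inl v
      att_over := fun _ _ _ => rfl
      att_smul := fun _ _ _ _ => rfl }
  exact ⟨D.tree, Sum.elim f id, hA.tree D ((cocompact_iff Y).1 hY).1 fun _ _ => rfl,
    fun y => ⟨.inr y, rfl⟩⟩

theorem exists_dist_le (hA : Admissible X₀ X Y f) :
    ∃ K, ∀ u v, X.graph.Adj u v → Y.graph.dist (f u) (f v) ≤ K + 1 := by
  obtain ⟨-, E, hE, hE'⟩ := (cocompact_iff X).1 hA.cocompact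
  obtain ⟨K, hK⟩ := (hE.image fun p => Y.graph.dist (f p.1) (f p.2)).bddAbove
  refine ⟨K, fun u v huv => ?_⟩
  obtain ⟨γ, p, hp, rfl, rfl⟩ := hE' u v huv
  rw [hA.equivariant, hA.equivariant, dist_smul]
  exact (hK ⟨p, hp, rfl⟩).trans K.le_succ

/-- Subdividing the edges of `X` makes an equivariant map to `Y` non-expanding. -/
theorem exists_dist_le_one (hA : Admissible X₀ X Y f) (hf : Function.Surjective f) :
    ∃ (X' : GTree G) (f' : X'.V → Y.V), Admissible X₀ X' Y f' ∧ Function.Surjective f' ∧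
      ∀ u v, X'.graph.Adj u v → Y.graph.dist (f' u) (f' v) ≤ 1 := by
  obtain ⟨K, hK⟩ := hA.exists_dist_le
  induction K generalizing X with
  | zero => exact ⟨X, f, hA, hf, hK⟩
  | succ K ih =>
    obtain ⟨P, hP, hasymm, htot⟩ := X.exists_orientation
    let s : X.V → X.V → Y.V := fun v u => Y.step (f v) (f u)
    have hs : ∀ γ v u, s (X.smul γ v) (X.smul γ u) = Y.smul γ (s v u) := fun γ v u => by
      simp only [s, hA.equivariant γ, step_smul]
    have hA' : Admissible X₀ (foldData hP hs).tree Y (foldMap hP hs f) :=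
      hA.tree (foldData hP hs) (foldData_finite hA.cocompact) fun _ _ => rfl
    refine ih hA' (fun y => (hf y).imp' Sum.inl fun _ h => h) fun z z' hz => ?_
    refine foldData_forall_adj hasymm htot
      (p := fun z z' => Y.graph.dist (foldMap hP hs f z) (foldMap hP hs f z') ≤ K + 1)
      (fun z z' h => by rwa [Y.graph.dist_comm]) ?_ ?_ hz
    · intro v u h hvu
      rw [foldMap_att h hvu]
      change Y.graph.dist (Y.step (f v) (f u)) (f v) ≤ _
      by_cases he : f v = f u
      · rw [he, step_self, SimpleGraph.dist_self]
        omega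
      · rw [SimpleGraph.dist_eq_one_iff_adj.2 (Y.step_spec he).1.symm]
        omega
    · intro v u h hvu
      rw [foldMap_att h hvu]
      change Y.graph.dist (Y.step (f v) (f u)) (f u) ≤ _
      by_cases he : f v = f u
      · rw [he, step_self, SimpleGraph.dist_self]
        omega
      · have := hK v u h
        have := (Y.step_spec he).2
        omega

theorem exists_simplicial (hA : Admissible X₀ X Y f) (hY : Y.Cocompact) :
    ∃ (X' : GTree G) (f' : X'.V → Y.V), Admissible X₀ X' Y f' ∧ Function.Surjective f' ∧
      ∀ u v, X'.graph.Adj u v → Y.graph.Adj (f' u) (f' v) := by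
  obtain ⟨X₁, f₁, hA₁, hf₁⟩ := hA.exists_surjective hY
  obtain ⟨X₂, f₂, hA₂, hf₂, h₂⟩ := hA₁.exists_dist_le_one hf₁
  obtain ⟨X₃, h, f₃, hA₃, hq, hz⟩ := hA₂.exists_quotient
  refine ⟨X₃, f₃, hA₃, fun y => (hf₂ y).imp' h fun x hx => (hq.comp x).trans hx,
    fun a b hab => ?_⟩
  have hne := hz a b hab
  obtain ⟨u, v, huv, rfl, rfl⟩ := hq.lift a b hab
  rw [hq.comp, hq.comp] at hne ⊢
  have := Y.isTree.connected.pos_dist_of_ne hne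
  exact SimpleGraph.dist_eq_one_iff_adj.1 (le_antisymm (h₂ u v huv) this)

end Admissible

end GTree

namespace SimpleGraph

variable {V W : Type*} {T : SimpleGraph V} {H : SimpleGraph W}

theorem Walk.exists_backtrack_of_not_isChain (F : T →g H) {u v : V} (p : T.Walk u v)
    (hp : ¬(p.map F).edges.IsChain (· ≠ ·)) :
    ∃ (a b c : V) (q : T.Walk u a) (r : T.Walk c v), T.Adj b a ∧ T.Adj b c ∧ F a = F c ∧
      q.length + r.length + 2 = p.length := by
  induction p with
  | nil => simp at hp
  | @cons u b v h p ih =>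
    by_cases hp' : (p.map F).edges.IsChain (· ≠ ·)
    · cases p with
      | nil => simp at hp
      | @cons _ c _ h' p =>
        refine ⟨u, b, c, .nil, p, h.symm, h', ?_, by simp only [length_cons, length_nil]; omega⟩
        simp only [map_cons, edges_cons, List.isChain_cons_cons] at hp hp'
        have h1 : s(F u, F b) = s(F b, F c) := by
          by_contra h1
          exact hp ⟨h1, hp'⟩
        rcases Sym2.eq_iff.1 h1 with ⟨h2, h3⟩ | ⟨h2, -⟩
        · exact h2.trans h3
        · exact h2
    · obtain ⟨a, b', c, q, r, h1, h2, h3, h4⟩ := ih hp'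
      exact ⟨a, b', c, .cons h q, r, h1, h2, h3, by simp only [length_cons]; omega⟩

theorem Walk.exists_backtrack (hH : H.IsAcyclic) (F : T →g H) {u v : V} (p : T.Walk u v)
    (hne : u ≠ v) (hF : F u = F v) :
    ∃ (a b c : V) (q : T.Walk u a) (r : T.Walk c v), T.Adj b a ∧ T.Adj b c ∧ F a = F c ∧
      q.length + r.length + 2 = p.length := by
  refine p.exists_backtrack_of_not_isChain F fun hc => hne ?_
  have hpath := (hH.isPath_iff_isChain _).2 hc
  have key : ∀ {b : W} (w : H.Walk (F u) b), F u = b → w.IsPath → w.length = 0 := by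
    rintro b w rfl hw
    exact Walk.length_eq_zero_iff.2 (Walk.isPath_iff_nil.1 hw)
  have := key _ hF hpath
  rw [length_map] at this
  exact Walk.eq_of_length_eq_zero this

end SimpleGraph

namespace GTree

variable {G : Type u} [Group G]

namespace Admissible

variable {X₀ X Y : GTree G} {f : X.V → Y.V}

/-- All the edges issuing from the same vertex in positive directions with the same image can be
folded by an elementary deformation. -/
theorem exists_positive_fold (hA : Admissible X₀ X Y f)
    (hadj : ∀ u v, X.graph.Adj u v → Y.graph.Adj (f u) (f v)) {P : Y.V → Y.V → Prop}
    (hP : ∀ γ a b, P (Y.smul γ a) (Y.smul γ b) ↔ P a b) (hasymm : ∀ a b, P a b → ¬P b a)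
    (htot : ∀ a b, Y.graph.Adj a b → P a b ∨ P b a) :
    ∃ (X' : GTree G) (k : X.V → X'.V) (f' : X'.V → Y.V), Admissible X₀ X' Y f' ∧
      (∀ u v, X'.graph.Adj u v → Y.graph.Adj (f' u) (f' v)) ∧ Function.Surjective k ∧
      (∀ u v, X.graph.Adj u v → X'.graph.Adj (k u) (k v)) ∧ (∀ x, f' (k x) = f x) ∧
      ∀ v u u', X.graph.Adj v u → X.graph.Adj v u' → f u = f u' → P (f v) (f u) → k u = k u' := by
  let R : X.V → X.V → Prop := fun v u => P (f v) (f u)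
  let s : X.V → X.V → Y.V := fun _ u => f u
  have hR : ∀ γ v u, R (X.smul γ v) (X.smul γ u) ↔ R v u := fun γ v u => by
    simp only [R, hA.equivariant γ, hP]
  have hs : ∀ γ v u, s (X.smul γ v) (X.smul γ u) = Y.smul γ (s v u) := fun γ v u =>
    hA.equivariant γ u
  have hRasymm : ∀ v u, R v u → ¬R u v := fun v u => hasymm _ _
  have hA' : Admissible X₀ (foldData hR hs).tree Y (foldMap hR hs f) :=
    hA.tree (foldData hR hs) (foldData_finite hA.cocompact) fun _ _ => rfl
  obtain ⟨X', h, f', hA'', hq, hz⟩ := hA'.exists_quotient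
  have hcomp : ∀ z : X.V ⊕ (foldData hR hs).N, f' (h z) = foldMap hR hs f z := hq.comp
  have hkey : ∀ v u, X.graph.Adj v u → R v u → h ((foldData hR hs).att v u) = h (.inl u) := by
    intro v u hvu hvu'
    refine (hq.adj _ _ (foldData_adj hRasymm hvu hvu')).resolve_right fun hX' => hz _ _ hX' ?_
    rw [hcomp, foldMap_att hvu hvu']
    exact (hcomp (.inl u)).symm
  have hk : ∀ v u, X.graph.Adj v u → R v u → X'.graph.Adj (h (.inl v)) (h (.inl u)) := by
    intro v u hvu hvu'
    rw [← hkey v u hvu hvu']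
    refine ((hq.adj _ _ (foldData_adj' hvu hvu')).resolve_left fun he => ?_).symm
    have := congrArg f' he
    rw [hcomp, foldMap_att hvu hvu'] at this
    exact (hadj v u hvu).ne' (this.trans (hcomp (.inl v)))
  refine ⟨X', fun x => h (.inl x), f', hA'', fun a b hab => ?_, fun a => ?_, fun u v huv => ?_,
    fun x => hcomp (.inl x), fun v u u' hu hu' he hvu => ?_⟩
  · have hne := hz a b hab
    obtain ⟨z, z', hzz', rfl, rfl⟩ := hq.lift a b hab
    rw [hq.comp, hq.comp] at hne ⊢
    refine (foldData_forall_adj hRasymm (fun v u hvu => htot _ _ (hadj v u hvu))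
      (p := fun z z' => foldMap hR hs f z = foldMap hR hs f z' ∨
        Y.graph.Adj (foldMap hR hs f z) (foldMap hR hs f z')) ?_ ?_ ?_ hzz').resolve_left hne
    · exact fun z z' h => h.imp Eq.symm SimpleGraph.Adj.symm
    · intro v u hvu hvu'
      rw [foldMap_att hvu hvu']
      exact Or.inr (hadj v u hvu).symm
    · intro v u hvu hvu'
      rw [foldMap_att hvu hvu']
      exact Or.inl rfl
  · obtain ⟨z, rfl⟩ := hq.surjective a
    rcases z with x | ⟨⟨v, y⟩, u, hvu, hvu', hy⟩
    · exact ⟨x, rfl⟩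
    · dsimp only at hvu hvu' hy
      subst hy
      refine ⟨u, ?_⟩
      dsimp only
      rw [← hkey v u hvu hvu', foldData_att_of hvu hvu']
  · rcases htot _ _ (hadj u v huv) with h' | h'
    · exact hk u v huv h'
    · exact (hk v u huv.symm h').symm
  · have hvu' : R v u' := by
      change P (f v) (f u')
      rwa [← he]
    dsimp only
    rw [← hkey v u hu hvu, ← hkey v u' hu' hvu', foldData_att_of hu hvu, foldData_att_of hu' hvu']
    congr 3
    exact Prod.ext rfl he

/-- All the edges issuing from the same vertex with the same image can be folded by an elementary
deformation. -/
theorem exists_fold (hA : Admissible X₀ X Y f)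
    (hadj : ∀ u v, X.graph.Adj u v → Y.graph.Adj (f u) (f v)) :
    ∃ (X' : GTree G) (k : X.V → X'.V) (f' : X'.V → Y.V), Admissible X₀ X' Y f' ∧
      (∀ u v, X'.graph.Adj u v → Y.graph.Adj (f' u) (f' v)) ∧ Function.Surjective k ∧
      (∀ u v, X.graph.Adj u v → X'.graph.Adj (k u) (k v)) ∧ (∀ x, f' (k x) = f x) ∧
      ∀ v u u', X.graph.Adj v u → X.graph.Adj v u' → f u = f u' → k u = k u' := by
  obtain ⟨P, hP, hasymm, htot⟩ := Y.exists_orientation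
  obtain ⟨X₁, k₁, f₁, hA₁, hadj₁, hs₁, hk₁, hc₁, hf₁⟩ :=
    hA.exists_positive_fold hadj hP hasymm htot
  obtain ⟨X₂, k₂, f₂, hA₂, hadj₂, hs₂, hk₂, hc₂, hf₂⟩ :=
    hA₁.exists_positive_fold hadj₁ (P := fun a b => P b a) (fun γ a b => hP γ b a)
      (fun a b => hasymm b a) (fun a b h => htot b a h.symm)
  refine ⟨X₂, k₂ ∘ k₁, f₂, hA₂, hadj₂, hs₂.comp hs₁, fun u v h => hk₂ _ _ (hk₁ _ _ h),
    fun x => (hc₂ _).trans (hc₁ x), fun v u u' hu hu' he => ?_⟩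
  rcases htot _ _ (hadj v u hu) with h | h
  · exact congrArg k₂ (hf₁ v u u' hu hu' he h)
  · refine hf₂ _ _ _ (hk₁ _ _ hu) (hk₁ _ _ hu') ?_ ?_
    · rw [hc₁, hc₁, he]
    · rwa [hc₁, hc₁]

theorem exists_fiber_bound (hA : Admissible X₀ X Y f) :
    ∃ M, ∀ u v, f u = f v → X.graph.dist u v ≤ M := by
  obtain ⟨-, g, hg⟩ := (sameEllipticSubgroups_iff X Y).1 hA.same
  obtain ⟨⟨F, hF, hF'⟩, -⟩ := (cocompact_iff X).1 hA.cocompact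
  obtain ⟨B, hB⟩ := (hF.image fun x => X.graph.dist x (g (f x))).bddAbove
  have key : ∀ x, X.graph.dist x (g (f x)) ≤ B := by
    intro x
    obtain ⟨γ, y, hy, rfl⟩ := hF' x
    rw [hA.equivariant, hg, dist_smul]
    exact hB ⟨y, hy, rfl⟩
  refine ⟨B + B, fun u v huv => ?_⟩
  refine (X.isTree.connected.dist_triangle (v := g (f u))).trans (add_le_add (key u) ?_)
  rw [huv, X.graph.dist_comm]
  exact key v

theorem elemDeformation (hA : Admissible X₀ X Y f) (hf : Function.Surjective f)
    (hadj : ∀ u v, X.graph.Adj u v → Y.graph.Adj (f u) (f v)) : ElemDeformation X₀ Y := by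
  obtain ⟨M, hM⟩ := hA.exists_fiber_bound
  induction M generalizing X with
  | zero =>
    have hinj : Function.Injective f := fun u v huv =>
      X.isTree.connected.dist_eq_zero_iff.1 (Nat.le_zero.1 (hM u v huv))
    exact hA.elem.trans _ _ _ (hA.equivariant.isGIso ⟨hinj, hf⟩ hadj).elemDeformation
  | succ M ih =>
    obtain ⟨X', k, f', hA', hadj', hks, hk, hc, hfold⟩ := hA.exists_fold hadj
    refine ih hA' (fun y => (hf y).imp' k fun x hx => (hc x).trans hx) hadj' fun a b hab => ?_
    obtain ⟨u, rfl⟩ := hks a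
    obtain ⟨v, rfl⟩ := hks b
    rw [hc, hc] at hab
    by_cases huv : u = v
    · rw [huv, SimpleGraph.dist_self]
      exact M.zero_le
    obtain ⟨p, hp⟩ := X.isTree.connected.exists_walk_length_eq_dist u v
    obtain ⟨x, y, z, q, r, hyx, hyz, hxz, hl⟩ := p.exists_backtrack Y.isTree.isAcyclic
      (⟨f, fun {a b} h => hadj a b h⟩ : X.graph →g Y.graph) huv hab
    let K : X.graph →g X'.graph := ⟨k, fun {a b} h => hk a b h⟩
    have hkxz : K x = K z := hfold y x z hyx hyz hxz
    have := SimpleGraph.dist_le (((q.map K).copy rfl hkxz).append (r.map K))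
    have := hM u v hab
    simp only [SimpleGraph.Walk.length_append, SimpleGraph.Walk.length_copy,
      SimpleGraph.Walk.length_map] at *
    change X'.graph.dist (K u) (K v) ≤ M
    omega

end Admissible

end GTree

open GTree in
/-- Theorem 4.2: let `G` be a group and let `X` and `Y` be cocompact
`G`-trees.  Then `X` and `Y` are related by an elementary deformation if and
only if they have the same elliptic subgroups. -/
theorem elemDeformation_iff_sameEllipticSubgroups {G : Type u} [Group G]
    (X Y : GTree G) (hXc : X.Cocompact) (hYc : Y.Cocompact) :
    ElemDeformation X Y ↔ X.SameEllipticSubgroups Y := by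
  refine ⟨fun h => h.sameEllipticSubgroups, fun h => ?_⟩
  obtain ⟨f, hf⟩ := ((sameEllipticSubgroups_iff X Y).1 h).1
  have hA : Admissible X X Y f := ⟨.refl _, hXc, h, hf⟩
  obtain ⟨X', f', hA', hf', hadj⟩ := hA.exists_simplicial hYc
  exact hA'.elemDeformation hf' hadj
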